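/- Maximum plastic dissipation for the von Mises model with kinematic hardening: in the plastic case |s^tr| > Y, setting χ_k = β_k/a and χ_{k−1} = β_{k−1}/a, the return-mapping updates satisfy the variational inequality (ε^p_k − ε^p_{k−1}) : (τ_σ − σ_k) + (χ_{k−1} − χ_k) : (τ_β − β_k) ≤ 0 for every pair (τ_σ, τ_β) ∈ Sym(3) × Sym(3) with |dev(τ_σ − τ_β)| ≤ Y. -/

import Mathlib

open Matrix

/-- Frobenius inner product on 3×3 real matrices. -/
noncomputable def frob (σ τ : Matrix (Fin 3) (Fin 3) ℝ) : ℝ := ∑ i, ∑ j, σ i j * τ i j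

/-- Frobenius norm. -/
noncomputable def fnorm (τ : Matrix (Fin 3) (Fin 3) ℝ) : ℝ := Real.sqrt (frob τ τ)

/-- Deviatoric part. -/
noncomputable def devM (τ : Matrix (Fin 3) (Fin 3) ℝ) : Matrix (Fin 3) (Fin 3) ℝ :=
  τ - (Matrix.trace τ / 3) • (1 : Matrix (Fin 3) (Fin 3) ℝ)

/-- The isotropic elasticity tensor `ℂε = K tr(ε) I + 2G dev(ε)`. -/
noncomputable def Celast (K G : ℝ) (ε : Matrix (Fin 3) (Fin 3) ℝ) : Matrix (Fin 3) (Fin 3) ℝ :=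
  (K * Matrix.trace ε) • (1 : Matrix (Fin 3) (Fin 3) ℝ) + (2 * G) • devM ε

lemma frob_sub_right (A B C : Matrix (Fin 3) (Fin 3) ℝ) :
    frob A (B - C) = frob A B - frob A C := by
  simp [frob, mul_sub, Finset.sum_sub_distrib]

lemma frob_add_right (A B C : Matrix (Fin 3) (Fin 3) ℝ) :
    frob A (B + C) = frob A B + frob A C := by
  simp [frob, mul_add, Finset.sum_add_distrib]

lemma frob_smul_left (c : ℝ) (A B : Matrix (Fin 3) (Fin 3) ℝ) :
    frob (c • A) B = c * frob A B := by
  simp [frob, Finset.mul_sum, mul_assoc]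

lemma frob_smul_right (c : ℝ) (A B : Matrix (Fin 3) (Fin 3) ℝ) :
    frob A (c • B) = c * frob A B := by
  simp [frob, Finset.mul_sum, mul_left_comm]

lemma frob_one_right (A : Matrix (Fin 3) (Fin 3) ℝ) : frob A 1 = A.trace := by
  simp [frob, Matrix.one_apply, Matrix.trace]

lemma frob_self_nonneg (A : Matrix (Fin 3) (Fin 3) ℝ) : 0 ≤ frob A A :=
  Finset.sum_nonneg fun _ _ => Finset.sum_nonneg fun _ _ => mul_self_nonneg _

lemma fnorm_mul_self (A : Matrix (Fin 3) (Fin 3) ℝ) : fnorm A * fnorm A = frob A A :=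
  Real.mul_self_sqrt (frob_self_nonneg A)

/-- The Cauchy–Schwarz inequality for the Frobenius inner product. -/
lemma frob_le_fnorm_mul_fnorm (A B : Matrix (Fin 3) (Fin 3) ℝ) :
    frob A B ≤ fnorm A * fnorm B := by
  have h := Real.sum_mul_le_sqrt_mul_sqrt Finset.univ
    (fun p : Fin 3 × Fin 3 => A p.1 p.2) (fun p => B p.1 p.2)
  simpa only [fnorm, frob, Fintype.sum_prod_type, pow_two] using h

lemma trace_devM (A : Matrix (Fin 3) (Fin 3) ℝ) : (devM A).trace = 0 := by
  simp [devM]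

/-- A trace-free matrix only sees the deviatoric part of the other factor. -/
lemma frob_devM_right {A : Matrix (Fin 3) (Fin 3) ℝ} (hA : A.trace = 0)
    (B : Matrix (Fin 3) (Fin 3) ℝ) : frob A (devM B) = frob A B := by
  rw [devM, frob_sub_right, frob_smul_right, frob_one_right, hA, mul_zero, sub_zero]

/-- Maximum plastic dissipation for the von Mises model with kinematic hardening: in the
plastic case, with `χₖ = βₖ/a` and `χₖ₋₁ = βₖ₋₁/a`, the return-mapping updates satisfy
`(εₖᵖ − εₖ₋₁ᵖ) : (τσ − σₖ) + (χₖ₋₁ − χₖ) : (τβ − βₖ) ≤ 0` for every admissible pair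
`(τσ, τβ)` with `|dev(τσ − τβ)| ≤ Y`. -/
theorem vonMises_max_plastic_dissipation (K G a Y : ℝ) (hK : 0 < K) (hG : 0 < G)
    (ha : 0 < a) (hY : 0 < Y) (εk εp βp : Matrix (Fin 3) (Fin 3) ℝ)
    (hεk : εk.IsSymm) (hεp : εp.IsSymm) (hβp : βp.IsSymm) (hβtr : Matrix.trace βp = 0)
    (σtr str ntr σk βk εpk χk χp : Matrix (Fin 3) (Fin 3) ℝ) (Δlam : ℝ)
    (hσtr : σtr = Celast K G (εk - εp))
    (hstr : str = devM σtr - βp)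
    (hplastic : Y < fnorm str)
    (hntr : ntr = (fnorm str)⁻¹ • str)
    (hΔlam : Δlam = (fnorm str - Y) / (2 * G + a))
    (hσk : σk = σtr - (2 * G * Δlam) • ntr)
    (hβk : βk = βp + (a * Δlam) • ntr)
    (hεpk : εpk = εp + Δlam • ntr)
    (hχk : χk = a⁻¹ • βk) (hχp : χp = a⁻¹ • βp) :
    ∀ τσ τβ : Matrix (Fin 3) (Fin 3) ℝ, τσ.IsSymm → τβ.IsSymm →
      fnorm (devM (τσ - τβ)) ≤ Y →
      frob (εpk - εp) (τσ - σk) + frob (χp - χk) (τβ - βk) ≤ 0 := by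
  intro τσ τβ _ _ hτ
  have hN : 0 < fnorm str := hY.trans hplastic
  have hΔ : 0 ≤ Δlam := by
    rw [hΔlam]
    exact div_nonneg (by linarith) (by linarith)
  have htr : str.trace = 0 := by
    rw [hstr, Matrix.trace_sub, trace_devM, hβtr, sub_zero]
  have hntr_trace : ntr.trace = 0 := by
    rw [hntr, Matrix.trace_smul, htr, smul_zero]
  have hn_str : frob ntr str = fnorm str := by
    rw [hntr, frob_smul_left, ← fnorm_mul_self, inv_mul_cancel_left₀ hN.ne']
  have hnn : frob ntr ntr = 1 := by
    conv_lhs => rw [hntr, frob_smul_right, ← hntr, hn_str]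
    exact inv_mul_cancel₀ hN.ne'
  have hn_norm : fnorm ntr = 1 := by rw [fnorm, hnn, Real.sqrt_one]
  have hadm : frob ntr τσ - frob ntr τβ ≤ Y := by
    rw [← frob_sub_right, ← frob_devM_right hntr_trace]
    simpa [hn_norm] using (frob_le_fnorm_mul_fnorm ntr (devM (τσ - τβ))).trans
      (mul_le_mul_of_nonneg_left hτ (by rw [hn_norm]; exact zero_le_one))
  have htrial : frob ntr σtr - frob ntr βp = fnorm str := by
    rw [← hn_str, hstr, frob_sub_right, frob_devM_right hntr_trace]
  have hyield : frob ntr σk - frob ntr βk = Y := by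
    have hΔ' : Δlam * (2 * G + a) = fnorm str - Y := by
      rw [hΔlam]
      exact div_mul_cancel₀ _ (by linarith)
    rw [hσk, hβk, frob_sub_right, frob_add_right, frob_smul_right, frob_smul_right, hnn]
    linarith
  have hε : εpk - εp = Δlam • ntr := by rw [hεpk, add_sub_cancel_left]
  have hχ : χp - χk = (-Δlam) • ntr := by
    rw [hχp, hχk, hβk, smul_add, smul_smul, inv_mul_cancel_left₀ ha.ne', neg_smul]
    abel
  rw [hε, hχ, frob_smul_left, frob_smul_left, frob_sub_right, frob_sub_right]
  have := mul_nonneg hΔ (sub_nonneg.2 (hadm.trans_eq hyield.symm))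
  linarith
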